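/- Fix integers n ≥ 1, K ≥ 1, T ≥ 1 and let B := {j/K : j = 0,1,…,K}. For each i let μ_i be a Borel probability measure on [0,1] with continuous CDF F_i and quantile function φ_i(q) := inf{v ∈ [0,1] : F_i(v) ≥ q}; let μ := μ_1 ⊗ … ⊗ μ_n. For each round t = 1,…,T and bidder i let x_i^{(t)} : B^n → [0,1] with Σ_{i=1}^n x_i^{(t)}(b) ≤ 1 for all b, with x_i^{(t)} nondecreasing in its i-th argument, and let p_i^{(t)} : B^n → [0,1] with p_i^{(t)}(0, b_{−i}) = 0 for all b_{−i}. For each i, t let π^{(i,t)} be in the standard simplex Δ ⊂ ℝ^{K+1} and let s_i^{(t)} : [0,1] → B be the quantile bidding strategy of π^{(i,t)} with respect to μ_i; for b_{−i} ∈ B^{n−1} define G_i^{(t)}(b_{−i}) ∈ ℝ^{K+1} by G_{i,k}^{(t)}(b_{−i}) := Σ_{j=k}^{K} (x_i^{(t)}((j−1)/K, b_{−i}) − x_i^{(t)}(j/K, b_{−i}))·φ_i(Π_j(π^{(i,t)})) + x_i^{(t)}(1, b_{−i}) − p_i^{(t)}((k−1)/K, b_{−i}). Define Mye(μ) as the supremum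 of Σ_{i=1}^n ∫_{[0,1]^n} p̂_i dμ over all families of measurable functions x̂_i : [0,1]^n → [0,1] with Σ_i x̂_i(v) ≤ 1 for all v and measurable p̂_i : [0,1]^n → ℝ satisfying, for all i, all v ∈ [0,1]^n and all b_i ∈ [0,1]: x̂_i(v_i, v_{−i})·v_i − p̂_i(v_i, v_{−i}) ≥ x̂_i(b_i, v_{−i})·v_i − p̂_i(b_i, v_{−i}) (incentive compatibility) and x̂_i(v)·v_i − p̂_i(v) ≥ 0 (individual rationality). Suppose that for each i there is R_i ∈ ℝ such that, with e := (1,0,…,0) ∈ ℝ^{K+1}, Σ_{t=1}^{T} ∫_{[0,1]^{n−1}} G_i^{(t)}((s_j^{(t)}(v_j))_{j≠i})·(e − π^{(i,t)}) d(⊗_{j≠i} μ_j)(v_{−i}) ≤ R_i. Then the auctioneer's total expected revenue satisfies Σ_{t=1}^{T} Σ_{i=1}^{n} ∫_{[0,1]^n} p_i^{(t)}(s_1^{(t)}(v_1),…,s_n^{(t)}(v_n)) dμ(v) ≤ Mye(μ)·T + Σ_{i=1}^{n} R_i. -/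

import Mathlib

open MeasureTheory

/-- The finite bid set `B = {j/K : j = 0,…,K}`. -/
def BidSet (K : ℕ) : Set ℝ := {b | ∃ j ≤ K, b = (j : ℝ) / K}

/-- The box `[0,1]^n`. -/
def box (n : ℕ) : Set (Fin n → ℝ) := Set.univ.pi fun _ => Set.Icc (0 : ℝ) 1

/-- The CDF `F(v) = μ([0,v])` of a measure on `[0,1]`. -/
noncomputable def cdf (μ : Measure ℝ) (v : ℝ) : ℝ := (μ (Set.Icc 0 v)).toReal

/-- The quantile function `φ(q) = inf {v ∈ [0,1] : F(v) ≥ q}`. -/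
noncomputable def quant (μ : Measure ℝ) (q : ℝ) : ℝ :=
  sInf {v : ℝ | v ∈ Set.Icc (0 : ℝ) 1 ∧ q ≤ cdf μ v}

open scoped Classical in
/-- The quantile bidding strategy `s_π` of a quantile strategy `π` (indexed `π 0,…,π K`)
with respect to `μ`: since `quant μ` and the partial sums `Π_i = Σ_{ℓ<i} π ℓ` are
nondecreasing, counting the thresholds `φ(Π_i)` (`i = 1,…,K`) strictly below `v` gives
exactly the piecewise description `s_π v = 0` on `[0, φ(Π₁)]`, `s_π v = (j−1)/K` on
`(φ(Π_{j−1}), φ(Π_j)]` for `2 ≤ j ≤ K+1`, and `s_π v = 1` for `v > φ(1)`. -/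
noncomputable def sQ (K : ℕ) (μ : Measure ℝ) (π : ℕ → ℝ) (v : ℝ) : ℝ :=
  (((Finset.Icc 1 K).filter
      (fun i => quant μ (∑ ℓ ∈ Finset.range i, π ℓ) < v)).card : ℝ) / K

/-- The profile of bids `(s_1(v_1),…,s_n(v_n))`. -/
noncomputable def bidProfile {n : ℕ} (K : ℕ) (μ : Fin n → Measure ℝ)
    (π : Fin n → ℕ → ℝ) (v : Fin n → ℝ) : Fin n → ℝ :=
  fun m => sQ K (μ m) (π m) (v m)

/-- The gradient `G_i(b₋ᵢ)` of bidder `i`'s quantile utility, with 0-based index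
`k ∈ {0,…,K}` (paper index `k+1`); all occurrences of coordinate `i` of the profile `b`
are overridden, so `G` does not depend on `b i`. -/
noncomputable def Gmulti {n : ℕ} (K : ℕ) (μ : Fin n → Measure ℝ)
    (x p : Fin n → (Fin n → ℝ) → ℝ) (π : Fin n → ℕ → ℝ)
    (i : Fin n) (b : Fin n → ℝ) (k : ℕ) : ℝ :=
  (∑ j ∈ Finset.Icc (k + 1) K,
      (x i (Function.update b i (((j : ℝ) - 1) / K))
        - x i (Function.update b i ((j : ℝ) / K))) *
        quant (μ i) (∑ ℓ ∈ Finset.range j, π i ℓ))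
    + x i (Function.update b i 1) - p i (Function.update b i ((k : ℝ) / K))

/-- Myerson's optimal revenue `Mye(μ)`: the supremum of the expected total payment over
all incentive-compatible and individually rational auctions `(x̂, p̂)` on `[0,1]^n` with
`x̂ i` valued in `[0,1]`, `Σ_i x̂ i ≤ 1`. -/
noncomputable def Mye (n : ℕ) (μ : Fin n → Measure ℝ) : ℝ :=
  sSup {r : ℝ | ∃ xh ph : Fin n → (Fin n → ℝ) → ℝ,
    (∀ i, Measurable (xh i)) ∧ (∀ i, Measurable (ph i)) ∧
    (∀ i, ∀ v ∈ box n, xh i v ∈ Set.Icc (0 : ℝ) 1) ∧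
    (∀ v ∈ box n, ∑ i, xh i v ≤ 1) ∧
    (∀ i, ∀ v ∈ box n, ∀ b ∈ Set.Icc (0 : ℝ) 1,
      xh i (Function.update v i b) * v i - ph i (Function.update v i b)
        ≤ xh i v * v i - ph i v) ∧
    (∀ i, ∀ v ∈ box n, 0 ≤ xh i v * v i - ph i v) ∧
    r = ∑ i, ∫ v in box n, ph i v ∂(Measure.pi μ)}

section Quantile

variable {μ : Measure ℝ}

/-- The support condition makes `[0,1]` an almost sure event. -/
lemma ae_mem_Icc [IsProbabilityMeasure μ] (hμ : μ (Set.Icc (0 : ℝ) 1) = 1) :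
    ∀ᵐ u ∂μ, u ∈ Set.Icc (0 : ℝ) 1 :=
  mem_ae_iff_prob_eq_one measurableSet_Icc |>.2 hμ

lemma cdf_mono [IsFiniteMeasure μ] : Monotone (cdf μ) := fun _ _ h =>
  ENNReal.toReal_mono (measure_ne_top _ _) (measure_mono (Set.Icc_subset_Icc_right h))

lemma cdf_one (hμ : μ (Set.Icc (0 : ℝ) 1) = 1) : cdf μ 1 = 1 := by
  simp [cdf, hμ]

lemma quant_set_bddBelow (q : ℝ) :
    BddBelow {v : ℝ | v ∈ Set.Icc (0 : ℝ) 1 ∧ q ≤ cdf μ v} :=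
  ⟨0, fun _ hv => hv.1.1⟩

lemma quant_set_nonempty (hμ : μ (Set.Icc (0 : ℝ) 1) = 1) {q : ℝ} (hq : q ≤ 1) :
    {v : ℝ | v ∈ Set.Icc (0 : ℝ) 1 ∧ q ≤ cdf μ v}.Nonempty :=
  ⟨1, ⟨zero_le_one, le_rfl⟩, by rwa [cdf_one hμ]⟩

lemma quant_mono (hμ : μ (Set.Icc (0 : ℝ) 1) = 1) {q q' : ℝ} (h : q ≤ q') (hq' : q' ≤ 1) :
    quant μ q ≤ quant μ q' :=
  csInf_le_csInf (quant_set_bddBelow q) (quant_set_nonempty hμ hq')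
    fun _ hv => ⟨hv.1, h.trans hv.2⟩

/-- For a continuous CDF, the quantile function is a right inverse of the CDF. -/
lemma cdf_quant [IsProbabilityMeasure μ] (hμ : μ (Set.Icc (0 : ℝ) 1) = 1)
    (hF : ContinuousOn (cdf μ) (Set.Icc 0 1)) (hF0 : cdf μ 0 = 0)
    {q : ℝ} (hq0 : 0 ≤ q) (hq1 : q ≤ 1) : cdf μ (quant μ q) = q := by
  apply le_antisymm
  · obtain ⟨w, hw, rfl⟩ := intermediate_value_Icc zero_le_one hF
      (show q ∈ Set.Icc (cdf μ 0) (cdf μ 1) by rw [hF0, cdf_one hμ]; exact ⟨hq0, hq1⟩)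
    exact cdf_mono (csInf_le (quant_set_bddBelow _) ⟨hw, le_rfl⟩)
  · have hc : IsClosed {v : ℝ | v ∈ Set.Icc (0 : ℝ) 1 ∧ q ≤ cdf μ v} :=
      hF.preimage_isClosed_of_isClosed isClosed_Icc isClosed_Ici
    exact (hc.csInf_mem (quant_set_nonempty hμ hq1) (quant_set_bddBelow q)).2

lemma measureReal_Iic_quant [IsProbabilityMeasure μ] (hμ : μ (Set.Icc (0 : ℝ) 1) = 1)
    (hF : ContinuousOn (cdf μ) (Set.Icc 0 1)) (hF0 : cdf μ 0 = 0)
    {q : ℝ} (hq0 : 0 ≤ q) (hq1 : q ≤ 1) : μ.real (Set.Iic (quant μ q)) = q := by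
  refine Eq.trans (measureReal_congr ?_) (cdf_quant hμ hF hF0 hq0 hq1)
  filter_upwards [ae_mem_Icc hμ] with u hu
  exact propext ⟨fun h => ⟨hu.1, h⟩, fun h => h.2⟩

end Quantile

section BidIndex

open scoped Classical in
/-- The index `k` of the bid `k / K` prescribed by a quantile bidding strategy. -/
noncomputable def bidIndex (K : ℕ) (μ : Measure ℝ) (π : ℕ → ℝ) (v : ℝ) : ℕ :=
  ((Finset.Icc 1 K).filter (fun i => quant μ (∑ ℓ ∈ Finset.range i, π ℓ) < v)).card

variable {K : ℕ} {μ : Measure ℝ} {π : ℕ → ℝ}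

lemma sQ_eq_bidIndex_div (v : ℝ) : sQ K μ π v = (bidIndex K μ π v : ℝ) / K := rfl

lemma bidIndex_le (v : ℝ) : bidIndex K μ π v ≤ K :=
  (Finset.card_filter_le _ _).trans (by simp)

lemma bidIndex_mono : Monotone (bidIndex K μ π) := fun _ _ h =>
  Finset.card_le_card (Finset.monotone_filter_right _ fun _ _ hi => lt_of_lt_of_le hi h)

lemma partialSum_nonneg (hπ0 : ∀ k < K + 1, 0 ≤ π k) {j : ℕ} (hj : j ≤ K + 1) :
    0 ≤ ∑ ℓ ∈ Finset.range j, π ℓ :=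
  Finset.sum_nonneg fun k hk => hπ0 k ((Finset.mem_range.1 hk).trans_le hj)

lemma partialSum_mono (hπ0 : ∀ k < K + 1, 0 ≤ π k) {i j : ℕ} (hij : i ≤ j) (hj : j ≤ K + 1) :
    ∑ ℓ ∈ Finset.range i, π ℓ ≤ ∑ ℓ ∈ Finset.range j, π ℓ :=
  Finset.sum_le_sum_of_subset_of_nonneg (Finset.range_mono hij)
    fun k hk _ => hπ0 k ((Finset.mem_range.1 hk).trans_le hj)

lemma partialSum_le_one (hπ0 : ∀ k < K + 1, 0 ≤ π k)
    (hπ1 : ∑ k ∈ Finset.range (K + 1), π k = 1) {j : ℕ} (hj : j ≤ K + 1) :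
    ∑ ℓ ∈ Finset.range j, π ℓ ≤ 1 :=
  hπ1 ▸ partialSum_mono hπ0 hj le_rfl

lemma le_bidIndex_iff (hμ : μ (Set.Icc (0 : ℝ) 1) = 1) (hπ0 : ∀ k < K + 1, 0 ≤ π k)
    (hπ1 : ∑ k ∈ Finset.range (K + 1), π k = 1) {j : ℕ} (hj1 : 1 ≤ j) (hjK : j ≤ K) (v : ℝ) :
    j ≤ bidIndex K μ π v ↔ quant μ (∑ ℓ ∈ Finset.range j, π ℓ) < v := by
  classical
  have hmono : ∀ {i k : ℕ}, i ≤ k → k ≤ K →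
      quant μ (∑ ℓ ∈ Finset.range i, π ℓ) ≤ quant μ (∑ ℓ ∈ Finset.range k, π ℓ) :=
    fun hik hk => quant_mono hμ (partialSum_mono hπ0 hik (by omega))
      (partialSum_le_one hπ0 hπ1 (by omega))
  constructor
  · intro h
    by_contra hv
    have hsub : (Finset.Icc 1 K).filter
        (fun i => quant μ (∑ ℓ ∈ Finset.range i, π ℓ) < v) ⊆ Finset.Icc 1 (j - 1) := by
      intro i hi
      rw [Finset.mem_filter, Finset.mem_Icc] at hi
      rw [Finset.mem_Icc]
      refine ⟨hi.1.1, ?_⟩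
      by_contra hij
      exact hv ((hmono (by omega) hi.1.2).trans_lt hi.2)
    have hcard := Finset.card_le_card hsub
    rw [Nat.card_Icc] at hcard
    have : bidIndex K μ π v ≤ j - 1 + 1 - 1 := by
      unfold bidIndex
      convert hcard
    omega
  · intro h
    have hsub : Finset.Icc 1 j ⊆ (Finset.Icc 1 K).filter
        (fun i => quant μ (∑ ℓ ∈ Finset.range i, π ℓ) < v) := by
      intro i hi
      rw [Finset.mem_Icc] at hi
      rw [Finset.mem_filter, Finset.mem_Icc]
      exact ⟨⟨hi.1, hi.2.trans hjK⟩, (hmono hi.2 hjK).trans_lt h⟩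
    have hcard := Finset.card_le_card hsub
    rw [Nat.card_Icc, Nat.add_sub_cancel] at hcard
    unfold bidIndex
    convert hcard

/-- Under a continuous CDF, the bid index is below `j` with probability `Π_j`. -/
lemma measureReal_bidIndex_lt [IsProbabilityMeasure μ] (hμ : μ (Set.Icc (0 : ℝ) 1) = 1)
    (hF : ContinuousOn (cdf μ) (Set.Icc 0 1)) (hF0 : cdf μ 0 = 0)
    (hπ0 : ∀ k < K + 1, 0 ≤ π k) (hπ1 : ∑ k ∈ Finset.range (K + 1), π k = 1)
    {j : ℕ} (hj : j ≤ K + 1) :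
    μ.real {v | bidIndex K μ π v < j} = ∑ ℓ ∈ Finset.range j, π ℓ := by
  rcases Nat.eq_zero_or_pos j with rfl | hj0
  · simp
  rcases hj.eq_or_lt with rfl | hjK
  · have : {v | bidIndex K μ π v < K + 1} = Set.univ :=
      Set.eq_univ_of_forall fun v => Nat.lt_succ_of_le (bidIndex_le v)
    rw [this, hπ1, probReal_univ]
  · have : {v | bidIndex K μ π v < j} = Set.Iic (quant μ (∑ ℓ ∈ Finset.range j, π ℓ)) := by
      ext v
      have := le_bidIndex_iff (v := v) hμ hπ0 hπ1 hj0 (by omega : j ≤ K)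
      rw [Set.mem_ofPred_eq, Set.mem_Iic, ← not_lt, ← this, not_le]
    rw [this, measureReal_Iic_quant hμ hF hF0 (partialSum_nonneg hπ0 hj)
      (partialSum_le_one hπ0 hπ1 hj)]

lemma measurable_bidIndex : Measurable (bidIndex K μ π) := bidIndex_mono.measurable

lemma measureReal_bidIndex_eq [IsProbabilityMeasure μ] (hμ : μ (Set.Icc (0 : ℝ) 1) = 1)
    (hF : ContinuousOn (cdf μ) (Set.Icc 0 1)) (hF0 : cdf μ 0 = 0)
    (hπ0 : ∀ k < K + 1, 0 ≤ π k) (hπ1 : ∑ k ∈ Finset.range (K + 1), π k = 1)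
    {k : ℕ} (hk : k < K + 1) : μ.real {v | bidIndex K μ π v = k} = π k := by
  have hdiff : {v | bidIndex K μ π v = k} =
      {v | bidIndex K μ π v < k + 1} \ {v | bidIndex K μ π v < k} := by
    ext v
    simp only [Set.mem_ofPred_eq, Set.mem_sdiff]
    omega
  have hsub : {v | bidIndex K μ π v < k} ⊆ {v | bidIndex K μ π v < k + 1} :=
    fun v hv => Nat.lt_succ_of_lt hv
  rw [hdiff, measureReal_sdiff hsub (measurable_bidIndex measurableSet_Iio),
    measureReal_bidIndex_lt hμ hF hF0 hπ0 hπ1 hk,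
    measureReal_bidIndex_lt hμ hF hF0 hπ0 hπ1 hk.le, Finset.sum_range_succ]
  ring

/-- The bid index of a quantile strategy `π` has law `π`. -/
lemma integral_comp_bidIndex [IsProbabilityMeasure μ] (hμ : μ (Set.Icc (0 : ℝ) 1) = 1)
    (hF : ContinuousOn (cdf μ) (Set.Icc 0 1)) (hF0 : cdf μ 0 = 0)
    (hπ0 : ∀ k < K + 1, 0 ≤ π k) (hπ1 : ∑ k ∈ Finset.range (K + 1), π k = 1) (h : ℕ → ℝ) :
    ∫ u, h (bidIndex K μ π u) ∂μ = ∑ k ∈ Finset.range (K + 1), π k * h k := by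
  have hmeas : ∀ k, MeasurableSet {u | bidIndex K μ π u = k} := fun k =>
    measurable_bidIndex (measurableSet_singleton k)
  have hexp : ∀ u, h (bidIndex K μ π u) = ∑ k ∈ Finset.range (K + 1),
      Set.indicator {u | bidIndex K μ π u = k} (fun _ => h k) u := by
    intro u
    simp only [Set.indicator_apply, Set.mem_ofPred_eq]
    rw [Finset.sum_ite_eq, if_pos (Finset.mem_range.2 (Nat.lt_succ_of_le (bidIndex_le u)))]
  simp_rw [hexp]
  rw [integral_finsetSum _ fun k _ => (integrable_const (h k)).indicator (hmeas k)]
  refine Finset.sum_congr rfl fun k hk => ?_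
  rw [integral_indicator_const _ (hmeas k),
    measureReal_bidIndex_eq hμ hF hF0 hπ0 hπ1 (Finset.mem_range.1 hk), smul_eq_mul]

end BidIndex

section Product

/-- Resampling one coordinate independently preserves a product probability measure. -/
lemma measurePreserving_update {ι : Type*} [Fintype ι] [DecidableEq ι] {α : ι → Type*}
    [∀ i, MeasurableSpace (α i)] (μ : ∀ i, Measure (α i)) [∀ i, IsProbabilityMeasure (μ i)]
    (i : ι) :
    MeasurePreserving (fun z : (∀ j, α j) × α i => Function.update z.1 i z.2)
      ((Measure.pi μ).prod (μ i)) (Measure.pi μ) := by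
  have hm : Measurable (fun z : (∀ j, α j) × α i => Function.update z.1 i z.2) := by
    fun_prop
  refine ⟨hm, (Measure.pi_eq fun s hs => ?_).symm⟩
  rw [Measure.map_apply hm (MeasurableSet.univ_pi hs)]
  have hpre : (fun z : (∀ j, α j) × α i => Function.update z.1 i z.2) ⁻¹' Set.univ.pi s =
      Set.univ.pi (Function.update s i Set.univ) ×ˢ s i := by
    ext ⟨v, u⟩
    simp only [Set.mem_preimage, Set.mem_univ_pi, Set.mem_prod]
    constructor
    · intro h
      refine ⟨fun j => ?_, by simpa using h i⟩
      rcases eq_or_ne j i with rfl | hj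
      · simp
      · simpa [hj] using h j
    · rintro ⟨h, hu⟩ j
      rcases eq_or_ne j i with rfl | hj
      · simpa using hu
      · simpa [hj] using h j
  rw [hpre, Measure.prod_prod, Measure.pi_pi, ← Finset.mul_prod_erase _ _ (Finset.mem_univ i),
    ← Finset.mul_prod_erase _ (fun j => μ j (s j)) (Finset.mem_univ i)]
  have : ∀ j ∈ Finset.univ.erase i, μ j (Function.update s i Set.univ j) = μ j (s j) :=
    fun j hj => by rw [Function.update_of_ne (Finset.ne_of_mem_erase hj)]
  rw [Finset.prod_congr rfl this, Function.update_self, measure_univ, one_mul, mul_comm]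

variable {n K : ℕ} {μ : Fin n → Measure ℝ} {π : Fin n → ℕ → ℝ}

lemma pi_restrict_box [∀ i, IsProbabilityMeasure (μ i)]
    (hμ : ∀ i, μ i (Set.Icc (0 : ℝ) 1) = 1) :
    (Measure.pi μ).restrict (box n) = Measure.pi μ := by
  have hm : MeasurableSet (box n) := MeasurableSet.univ_pi fun _ => measurableSet_Icc
  refine Measure.restrict_eq_self_of_ae_mem ((mem_ae_iff_prob_eq_one hm).2 ?_)
  rw [box, Measure.pi_pi]
  simp [hμ]

/-- The profile `k ↦ k / K` of bids with given indices. -/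
noncomputable def bidOfIndex (K : ℕ) (κ : Fin n → ℕ) : Fin n → ℝ := fun m => (κ m : ℝ) / K

lemma bidProfile_update (v : Fin n → ℝ) (i : Fin n) (u : ℝ) :
    bidProfile K μ π (Function.update v i u) =
      Function.update (bidProfile K μ π v) i (sQ K (μ i) (π i) u) := by
  ext m
  rcases eq_or_ne m i with rfl | hm
  · simp [bidProfile]
  · simp [bidProfile, hm]

lemma bidProfile_mem (v : Fin n → ℝ) (m : Fin n) : bidProfile K μ π v m ∈ BidSet K :=
  ⟨_, bidIndex_le _, rfl⟩

lemma measurable_comp_bidProfile (f : (Fin n → ℝ) → ℝ) :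
    Measurable fun v => f (bidProfile K μ π v) := by
  have hidx : Measurable fun (v : Fin n → ℝ) m => bidIndex K (μ m) (π m) (v m) :=
    measurable_pi_lambda _ fun m => measurable_bidIndex.comp (measurable_pi_apply m)
  exact (Measurable.of_discrete (f := fun κ : Fin n → ℕ => f (bidOfIndex K κ))).comp hidx

lemma exists_bound_comp_bidProfile (f : (Fin n → ℝ) → ℝ) :
    ∃ C, ∀ v, ‖f (bidProfile K μ π v)‖ ≤ C := by
  obtain ⟨C, hC⟩ := ((Set.finite_Iic (fun _ : Fin n => K)).image
    fun κ => ‖f (bidOfIndex K κ)‖).bddAbove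
  exact ⟨C, fun v => hC ⟨_, fun _ => bidIndex_le _, rfl⟩⟩

lemma integrable_comp_bidProfile [∀ i, IsProbabilityMeasure (μ i)] (f : (Fin n → ℝ) → ℝ) :
    Integrable (fun v => f (bidProfile K μ π v)) (Measure.pi μ) := by
  obtain ⟨C, hC⟩ := exists_bound_comp_bidProfile (K := K) (μ := μ) (π := π) f
  exact Integrable.of_bound (measurable_comp_bidProfile f).aestronglyMeasurable C
    (Filter.Eventually.of_forall hC)

/-- Averaging over bidder `i`'s bid replaces it by a draw from the quantile strategy `π i`. -/
lemma integral_comp_bidProfile [∀ i, IsProbabilityMeasure (μ i)]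
    (hμ : ∀ i, μ i (Set.Icc (0 : ℝ) 1) = 1)
    (hF : ∀ i, ContinuousOn (cdf (μ i)) (Set.Icc 0 1)) (hF0 : ∀ i, cdf (μ i) 0 = 0)
    (hπ0 : ∀ i, ∀ k < K + 1, 0 ≤ π i k) (hπ1 : ∀ i, ∑ k ∈ Finset.range (K + 1), π i k = 1)
    (i : Fin n) (f : (Fin n → ℝ) → ℝ) :
    ∫ v, f (bidProfile K μ π v) ∂Measure.pi μ =
      ∫ v, ∑ k ∈ Finset.range (K + 1),
        π i k * f (Function.update (bidProfile K μ π v) i ((k : ℝ) / K)) ∂Measure.pi μ := by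
  have hmp := measurePreserving_update μ i
  have hint := integrable_comp_bidProfile (K := K) (μ := μ) (π := π) f
  conv_lhs => rw [← hmp.map_eq]
  rw [integral_map hmp.measurable.aemeasurable
    (measurable_comp_bidProfile f).aestronglyMeasurable]
  refine (integral_prod _ (hmp.integrable_comp_of_integrable hint)).trans ?_
  refine integral_congr_ae (Filter.Eventually.of_forall fun v => ?_)
  simp only [Function.comp_apply, bidProfile_update, sQ_eq_bidIndex_div]
  exact integral_comp_bidIndex (hμ i) (hF i) (hF0 i) (hπ0 i) (hπ1 i)
    fun k => f (Function.update (bidProfile K μ π v) i ((k : ℝ) / K))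

end Product

section Auction

variable {n K : ℕ} {μ : Fin n → Measure ℝ} {π : Fin n → ℕ → ℝ}

/-- The increase of bidder `i`'s allocation when the bid moves from `(j-1)/K` to `j/K`. -/
noncomputable def allocStep (K : ℕ) (x : Fin n → (Fin n → ℝ) → ℝ) (i : Fin n)
    (b : Fin n → ℝ) (j : ℕ) : ℝ :=
  x i (Function.update b i ((j : ℝ) / K)) - x i (Function.update b i (((j : ℝ) - 1) / K))

open scoped Classical in
/-- The incentive compatible payment: each allocation step is charged at the value threshold
at which the quantile strategy starts to bid for it. -/
noncomputable def thresholdPay (K : ℕ) (μ : Fin n → Measure ℝ) (x : Fin n → (Fin n → ℝ) → ℝ)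
    (π : Fin n → ℕ → ℝ) (i : Fin n) (b : Fin n → ℝ) : ℝ :=
  ∑ j ∈ Finset.Icc 1 K, if (j : ℝ) / K ≤ b i then
    allocStep K x i b j * quant (μ i) (∑ ℓ ∈ Finset.range j, π i ℓ) else 0

lemma allocStep_update (x : Fin n → (Fin n → ℝ) → ℝ) (i : Fin n) (b : Fin n → ℝ) (c : ℝ)
    (j : ℕ) : allocStep K x i (Function.update b i c) j = allocStep K x i b j := by
  simp [allocStep]

lemma div_le_div_iff_natCast (hK : 1 ≤ K) (j k : ℕ) :
    (j : ℝ) / K ≤ (k : ℝ) / K ↔ j ≤ k := by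
  have : (0 : ℝ) < K := by exact_mod_cast hK
  rw [div_le_div_iff_of_pos_right this, Nat.cast_le]

lemma filter_Icc_le {k : ℕ} (hk : k ≤ K) :
    (Finset.Icc 1 K).filter (fun j => j ≤ k) = Finset.Icc 1 k := by
  ext j
  simp only [Finset.mem_filter, Finset.mem_Icc]
  omega

lemma thresholdPay_update (hK : 1 ≤ K) (x : Fin n → (Fin n → ℝ) → ℝ) (i : Fin n)
    (b : Fin n → ℝ) {k : ℕ} (hk : k ≤ K) :
    thresholdPay K μ x π i (Function.update b i ((k : ℝ) / K)) =
      ∑ j ∈ Finset.Icc 1 k,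
        allocStep K x i b j * quant (μ i) (∑ ℓ ∈ Finset.range j, π i ℓ) := by
  simp only [thresholdPay, allocStep_update, Function.update_self, div_le_div_iff_natCast hK]
  rw [← Finset.sum_filter, filter_Icc_le hk]

lemma alloc_update_eq_sum (x : Fin n → (Fin n → ℝ) → ℝ) (i : Fin n) (b : Fin n → ℝ) (k : ℕ) :
    x i (Function.update b i ((k : ℝ) / K)) =
      x i (Function.update b i 0) + ∑ j ∈ Finset.Icc 1 k, allocStep K x i b j := by
  induction k with
  | zero => simp
  | succ k ih =>
    rw [Finset.sum_Icc_succ_top (by omega), ← add_assoc, ← ih, allocStep]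
    push_cast
    rw [add_sub_cancel_right]
    ring

/-- The regret of `π i` against bidding zero, linearized at the opponents' bids, is the
expected excess of the payment over the threshold payment. -/
lemma sum_Gmulti_mul_eq (hK : 1 ≤ K) (x p : Fin n → (Fin n → ℝ) → ℝ) (i : Fin n)
    (b : Fin n → ℝ) (hp0 : p i (Function.update b i 0) = 0)
    (hπ1 : ∑ k ∈ Finset.range (K + 1), π i k = 1) :
    ∑ k ∈ Finset.range (K + 1),
        Gmulti K μ x p π i b k * ((if k = 0 then (1 : ℝ) else 0) - π i k) =
      ∑ k ∈ Finset.range (K + 1), π i k *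
        (p i (Function.update b i ((k : ℝ) / K)) -
          thresholdPay K μ x π i (Function.update b i ((k : ℝ) / K))) := by
  have hdiff : ∀ k ∈ Finset.range (K + 1), Gmulti K μ x p π i b 0 - Gmulti K μ x p π i b k =
      p i (Function.update b i ((k : ℝ) / K)) -
        thresholdPay K μ x π i (Function.update b i ((k : ℝ) / K)) := by
    intro k hk
    have hkK : k ≤ K := Nat.lt_succ_iff.1 (Finset.mem_range.1 hk)
    rw [thresholdPay_update hK x i b hkK]
    have hsplit := Finset.sum_Ioc_consecutive (fun j : ℕ =>
      allocStep K x i b j * quant (μ i) (∑ ℓ ∈ Finset.range j, π i ℓ)) (Nat.zero_le k) hkK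
    have hneg : ∀ m : ℕ, ∑ j ∈ Finset.Icc (m + 1) K,
        (x i (Function.update b i (((j : ℝ) - 1) / K))
          - x i (Function.update b i ((j : ℝ) / K))) *
          quant (μ i) (∑ ℓ ∈ Finset.range j, π i ℓ) =
        -∑ j ∈ Finset.Ioc m K,
          allocStep K x i b j * quant (μ i) (∑ ℓ ∈ Finset.range j, π i ℓ) := by
      intro m
      rw [← Finset.sum_neg_distrib]
      refine Finset.sum_congr (by ext j; simp) fun j _ => ?_
      rw [allocStep]
      ring
    have hIcc : Finset.Icc 1 k = Finset.Ioc 0 k := by ext j; simp [Nat.succ_le_iff]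
    rw [Gmulti, Gmulti, hneg, hneg, ← hsplit, hIcc, Nat.cast_zero, zero_div, hp0]
    ring
  rw [← Finset.sum_congr rfl fun k hk => congrArg (π i k * ·) (hdiff k hk)]
  simp only [mul_sub, Finset.sum_sub_distrib, ← Finset.sum_mul, hπ1, one_mul, mul_ite, mul_one,
    mul_zero, Finset.sum_ite_eq', Finset.mem_range, Nat.succ_pos, if_true]
  simp only [mul_comm]

lemma mye_set_bddAbove [∀ i, IsProbabilityMeasure (μ i)] :
    BddAbove {r : ℝ | ∃ xh ph : Fin n → (Fin n → ℝ) → ℝ,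
    (∀ i, Measurable (xh i)) ∧ (∀ i, Measurable (ph i)) ∧
    (∀ i, ∀ v ∈ box n, xh i v ∈ Set.Icc (0 : ℝ) 1) ∧
    (∀ v ∈ box n, ∑ i, xh i v ≤ 1) ∧
    (∀ i, ∀ v ∈ box n, ∀ b ∈ Set.Icc (0 : ℝ) 1,
      xh i (Function.update v i b) * v i - ph i (Function.update v i b)
        ≤ xh i v * v i - ph i v) ∧
    (∀ i, ∀ v ∈ box n, 0 ≤ xh i v * v i - ph i v) ∧
    r = ∑ i, ∫ v in box n, ph i v ∂(Measure.pi μ)} := by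
  refine ⟨∑ _i : Fin n, 1, ?_⟩
  rintro r ⟨xh, ph, -, -, hxh, -, -, hir, rfl⟩
  refine Finset.sum_le_sum fun i _ => ?_
  have hm : MeasurableSet (box n) := MeasurableSet.univ_pi fun _ => measurableSet_Icc
  by_cases hint : IntegrableOn (ph i) (box n) (Measure.pi μ)
  · calc ∫ v in box n, ph i v ∂(Measure.pi μ)
        ≤ ∫ _ in box n, (1 : ℝ) ∂(Measure.pi μ) := by
          refine setIntegral_mono_on hint (integrable_const _) hm fun v hv => ?_
          have hvi : v i ∈ Set.Icc (0 : ℝ) 1 := hv i trivial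
          have := mul_le_one₀ (hxh i v hv).2 hvi.1 hvi.2
          linarith [hir i v hv]
      _ ≤ 1 := by
          rw [setIntegral_const, smul_eq_mul, mul_one]
          exact measureReal_le_one
  · rw [integral_undef hint]
    exact zero_le_one

/-- The expected threshold payments are the revenue of an incentive compatible and individually
rational auction. -/
lemma sum_integral_thresholdPay_le_mye [∀ i, IsProbabilityMeasure (μ i)] (hK : 1 ≤ K)
    (hμ : ∀ i, μ i (Set.Icc (0 : ℝ) 1) = 1)
    (hπ0 : ∀ i, ∀ k < K + 1, 0 ≤ π i k) (hπ1 : ∀ i, ∑ k ∈ Finset.range (K + 1), π i k = 1)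
    (x : Fin n → (Fin n → ℝ) → ℝ)
    (hx01 : ∀ i (b : Fin n → ℝ), (∀ j, b j ∈ BidSet K) → x i b ∈ Set.Icc (0 : ℝ) 1)
    (hxsum : ∀ b : Fin n → ℝ, (∀ j, b j ∈ BidSet K) → ∑ i, x i b ≤ 1)
    (hxmono : ∀ i (b : Fin n → ℝ), (∀ j, b j ∈ BidSet K) →
      ∀ c ∈ BidSet K, ∀ c' ∈ BidSet K, c ≤ c' →
        x i (Function.update b i c) ≤ x i (Function.update b i c')) :
    ∑ i, ∫ v, thresholdPay K μ x π i (bidProfile K μ π v) ∂(Measure.pi μ) ≤ Mye n μ := by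
  classical
  have hmem := fun v => bidProfile_mem (K := K) (μ := μ) (π := π) v
  have hzero : (0 : ℝ) ∈ BidSet K := ⟨0, Nat.zero_le _, by simp⟩
  set φ : Fin n → ℕ → ℝ := fun i j => quant (μ i) (∑ ℓ ∈ Finset.range j, π i ℓ) with hφ
  have hstep : ∀ i v, ∀ j ∈ Finset.Icc 1 K, 0 ≤ allocStep K x i (bidProfile K μ π v) j := by
    intro i v j hj
    rw [Finset.mem_Icc] at hj
    refine sub_nonneg.2 (hxmono i _ (hmem v) _ ⟨j - 1, by omega, ?_⟩ _ ⟨j, hj.2, rfl⟩ ?_)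
    · rw [Nat.cast_sub hj.1, Nat.cast_one]
    · gcongr
      linarith
  have hutil : ∀ i (v : Fin n → ℝ) (u w : ℝ),
      x i (bidProfile K μ π (Function.update v i u)) * w -
        thresholdPay K μ x π i (bidProfile K μ π (Function.update v i u)) =
      x i (Function.update (bidProfile K μ π v) i 0) * w +
        ∑ j ∈ Finset.Icc 1 K,
          if φ i j < u then allocStep K x i (bidProfile K μ π v) j * (w - φ i j) else 0 := by
    intro i v u w
    rw [bidProfile_update, sQ_eq_bidIndex_div, thresholdPay_update hK x i _ (bidIndex_le u),
      alloc_update_eq_sum x i, ← Finset.sum_filter]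
    have hfilter : (Finset.Icc 1 K).filter (fun j => φ i j < u) =
        Finset.Icc 1 (bidIndex K (μ i) (π i) u) := by
      rw [← filter_Icc_le (bidIndex_le u)]
      refine Finset.filter_congr fun j hj => ?_
      rw [Finset.mem_Icc] at hj
      exact (le_bidIndex_iff (hμ i) (hπ0 i) (hπ1 i) hj.1 hj.2 u).symm
    rw [hfilter, add_mul, Finset.sum_mul, add_sub_assoc, ← Finset.sum_sub_distrib]
    simp only [mul_sub, hφ]
  have hself : ∀ i (v : Fin n → ℝ), x i (bidProfile K μ π v) * v i -
        thresholdPay K μ x π i (bidProfile K μ π v) =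
      x i (Function.update (bidProfile K μ π v) i 0) * v i +
        ∑ j ∈ Finset.Icc 1 K,
          if φ i j < v i then allocStep K x i (bidProfile K μ π v) j * (v i - φ i j) else 0 := by
    intro i v
    simpa using hutil i v (v i) (v i)
  refine le_csSup mye_set_bddAbove ⟨fun i v => x i (bidProfile K μ π v),
    fun i v => thresholdPay K μ x π i (bidProfile K μ π v),
    fun i => measurable_comp_bidProfile _, fun i => measurable_comp_bidProfile _,
    fun i v _ => hx01 i _ (hmem v), fun v _ => hxsum _ (hmem v), ?_, ?_, ?_⟩
  · intro i v _ b _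
    rw [hutil, hself]
    gcongr with j hj
    have := hstep i v j hj
    split_ifs with h1 h2 h2
    · rfl
    · exact mul_nonpos_of_nonneg_of_nonpos this (by linarith)
    · exact mul_nonneg this (by linarith)
    · rfl
  · intro i v hv
    rw [hself]
    have hvi : v i ∈ Set.Icc (0 : ℝ) 1 := hv i trivial
    refine add_nonneg (mul_nonneg (hx01 i _ fun m => ?_).1 hvi.1)
      (Finset.sum_nonneg fun j hj => ?_)
    · rcases eq_or_ne m i with rfl | hm
      · simpa using hzero
      · simpa [hm] using hmem v m
    · split_ifs with h
      · exact mul_nonneg (hstep i v j hj) (by linarith)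
      · rfl
  · rw [pi_restrict_box hμ]

/-- In a single round, the expected payment of a bidder is the expected threshold payment plus
the expected linearized regret. -/
lemma integral_payment_eq [∀ i, IsProbabilityMeasure (μ i)] (hK : 1 ≤ K)
    (hμ : ∀ i, μ i (Set.Icc (0 : ℝ) 1) = 1)
    (hF : ∀ i, ContinuousOn (cdf (μ i)) (Set.Icc 0 1)) (hF0 : ∀ i, cdf (μ i) 0 = 0)
    (hπ0 : ∀ i, ∀ k < K + 1, 0 ≤ π i k) (hπ1 : ∀ i, ∑ k ∈ Finset.range (K + 1), π i k = 1)
    (x p : Fin n → (Fin n → ℝ) → ℝ) (i : Fin n)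
    (hp0 : ∀ b : Fin n → ℝ, (∀ j, b j ∈ BidSet K) → p i (Function.update b i 0) = 0) :
    ∫ v, p i (bidProfile K μ π v) ∂(Measure.pi μ) =
      ∫ v, thresholdPay K μ x π i (bidProfile K μ π v) ∂(Measure.pi μ) +
      ∫ v, (∑ k ∈ Finset.range (K + 1), Gmulti K μ x p π i (bidProfile K μ π v) k *
        ((if k = 0 then (1 : ℝ) else 0) - π i k)) ∂(Measure.pi μ) := by
  have h := integral_comp_bidProfile hμ hF hF0 hπ0 hπ1 i
    fun b => p i b - thresholdPay K μ x π i b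
  rw [integral_sub (integrable_comp_bidProfile _) (integrable_comp_bidProfile _)] at h
  exact sub_eq_iff_eq_add'.1 (h.trans (integral_congr_ae (Filter.Eventually.of_forall fun v =>
    (sum_Gmulti_mul_eq hK x p i _ (hp0 _ (bidProfile_mem v)) (hπ1 i)).symm)))

end Auction

/-- **strategic robustness.** If each round's auction format satisfies
allocation monotonicity and voluntary participation (and allocates at most one unit in
total), and each bidder `i`'s cumulative linearized regret against the quantile strategy
`e = (1,0,…,0)` is at most `R i`, then the auctioneer's total expected revenue over the
`T` rounds is at most `Mye(μ)·T + Σ_i R i`. -/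
theorem strategic_robustness
    (n K T : ℕ) (hn : 1 ≤ n) (hK : 1 ≤ K) (hT : 1 ≤ T)
    (μ : Fin n → Measure ℝ) [∀ i, IsProbabilityMeasure (μ i)]
    (hμ : ∀ i, μ i (Set.Icc (0 : ℝ) 1) = 1)
    (hFcont : ∀ i, ContinuousOn (cdf (μ i)) (Set.Icc 0 1))
    (hF0 : ∀ i, cdf (μ i) 0 = 0)
    (x p : ℕ → Fin n → (Fin n → ℝ) → ℝ)
    (hx01 : ∀ t < T, ∀ i (b : Fin n → ℝ), (∀ j, b j ∈ BidSet K) →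
      x t i b ∈ Set.Icc (0 : ℝ) 1)
    (hxsum : ∀ t < T, ∀ b : Fin n → ℝ, (∀ j, b j ∈ BidSet K) → ∑ i, x t i b ≤ 1)
    (hxmono : ∀ t < T, ∀ i (b : Fin n → ℝ), (∀ j, b j ∈ BidSet K) →
      ∀ c ∈ BidSet K, ∀ c' ∈ BidSet K, c ≤ c' →
        x t i (Function.update b i c) ≤ x t i (Function.update b i c'))
    (hp01 : ∀ t < T, ∀ i (b : Fin n → ℝ), (∀ j, b j ∈ BidSet K) →
      p t i b ∈ Set.Icc (0 : ℝ) 1)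
    (hp0 : ∀ t < T, ∀ i (b : Fin n → ℝ), (∀ j, b j ∈ BidSet K) →
      p t i (Function.update b i 0) = 0)
    (π : ℕ → Fin n → ℕ → ℝ)
    (hπ0 : ∀ t < T, ∀ i, ∀ k < K + 1, 0 ≤ π t i k)
    (hπ1 : ∀ t < T, ∀ i, ∑ k ∈ Finset.range (K + 1), π t i k = 1)
    (R : Fin n → ℝ)
    (hreg : ∀ i, ∑ t ∈ Finset.range T, ∫ v in box n,
        (∑ k ∈ Finset.range (K + 1),
          Gmulti K μ (x t) (p t) (π t) i (bidProfile K μ (π t) v) k *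
            ((if k = 0 then (1 : ℝ) else 0) - π t i k)) ∂(Measure.pi μ) ≤ R i) :
    ∑ t ∈ Finset.range T, ∑ i, ∫ v in box n,
        p t i (bidProfile K μ (π t) v) ∂(Measure.pi μ)
      ≤ Mye n μ * T + ∑ i, R i := by
  simp only [pi_restrict_box hμ] at hreg ⊢
  calc ∑ t ∈ Finset.range T, ∑ i, ∫ v, p t i (bidProfile K μ (π t) v) ∂(Measure.pi μ)
      = ∑ t ∈ Finset.range T,
          (∑ i, ∫ v, thresholdPay K μ (x t) (π t) i (bidProfile K μ (π t) v) ∂(Measure.pi μ) +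
          ∑ i, ∫ v, (∑ k ∈ Finset.range (K + 1),
            Gmulti K μ (x t) (p t) (π t) i (bidProfile K μ (π t) v) k *
              ((if k = 0 then (1 : ℝ) else 0) - π t i k)) ∂(Measure.pi μ)) := by
        refine Finset.sum_congr rfl fun t ht => ?_
        rw [← Finset.sum_add_distrib]
        have ht := Finset.mem_range.1 ht
        exact Finset.sum_congr rfl fun i _ => integral_payment_eq hK hμ hFcont hF0 (hπ0 t ht)
          (hπ1 t ht) (x t) (p t) i (hp0 t ht i)
    _ ≤ ∑ _t ∈ Finset.range T, Mye n μ + ∑ i, R i := by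
        rw [Finset.sum_add_distrib]
        refine add_le_add (Finset.sum_le_sum fun t ht => ?_) ?_
        · have ht := Finset.mem_range.1 ht
          exact sum_integral_thresholdPay_le_mye hK hμ (hπ0 t ht) (hπ1 t ht) (x t) (hx01 t ht)
            (hxsum t ht) (hxmono t ht)
        · rw [Finset.sum_comm]
          exact Finset.sum_le_sum fun i _ => hreg i
    _ = Mye n μ * T + ∑ i, R i := by
        rw [Finset.sum_const, Finset.card_range, nsmul_eq_mul, mul_comm]
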